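/- Let f be an independent broadcast on a connected graph G. If some vertex x with f(x) > 0 satisfies f(x) ≡ 0 (mod 4), then the weight of f satisfies Σ_{x∈V(G)} f(x) ≤ 4α(G) − 4. -/

import Mathlib

open scoped Classical

variable {V : Type*}

/-- The eccentricity of a vertex `x` in a finite graph `G`. -/
noncomputable def graphEcc [Fintype V] (G : SimpleGraph V) (x : V) : ℕ :=
  Finset.univ.sup fun y => G.dist x y

/-- The diameter of a finite graph `G`. -/
noncomputable def graphDiam [Fintype V] (G : SimpleGraph V) : ℕ :=
  Finset.univ.sup fun p : V × V => G.dist p.1 p.2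

/-- `f` is an independent broadcast on `G`: (B1) `f x` is at most the eccentricity of `x`,
and (B2) any two distinct vertices with positive values are at distance larger than both values. -/
def IsIndepBroadcast [Fintype V] (G : SimpleGraph V) (f : V → ℕ) : Prop :=
  (∀ x, f x ≤ graphEcc G x) ∧
  (∀ x y, x ≠ y → 0 < f x → 0 < f y → max (f x) (f y) < G.dist x y)

/-- The broadcast independence number of `G`: the maximum weight of an independent broadcast. -/
noncomputable def broadcastIndepNum [Fintype V] (G : SimpleGraph V) : ℕ :=
  sSup {w | ∃ f : V → ℕ, IsIndepBroadcast G f ∧ ∑ x, f x = w}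

/-- The independence number of `G`: the maximum size of a set of pairwise nonadjacent vertices. -/
noncomputable def indepNum [Fintype V] (G : SimpleGraph V) : ℕ :=
  sSup {n | ∃ S : Finset V, (∀ x ∈ S, ∀ y ∈ S, x ≠ y → ¬ G.Adj x y) ∧ S.card = n}

/-- The induced subgraph of `G` on `S` is a `k`-strip with partition `(B 0, …, B k)`. -/
def IsStripIn (G : SimpleGraph V) (S : Set V) (k : ℕ) (B : ℕ → Set V) : Prop :=
  (∀ i ≤ k, (B i).Nonempty ∧ B i ⊆ S) ∧
  (∀ i ≤ k, ∀ j ≤ k, i ≠ j → Disjoint (B i) (B j)) ∧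
  (S = ⋃ i ∈ Set.Iic k, B i) ∧
  (∀ i ≤ k, ∀ u ∈ B i, ∀ v ∈ B i, u ≠ v → G.Adj u v) ∧
  (∃ x, B 0 = {x}) ∧
  (∀ x, B 0 = {x} → ∀ i ≤ k, ∀ y, y ∈ B i → ∀ (hx : x ∈ S) (hy : y ∈ S),
      (G.induce S).dist ⟨x, hx⟩ ⟨y, hy⟩ = i) ∧
  (∀ i < k, Even i → ∀ u ∈ B i, ∀ v ∈ B (i + 1), G.Adj u v)

/-- `G` belongs to the class `𝒢₂(k)`: it is a connected graph arising from the disjoint union of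
two `(2k+1)`-strips by adding some edges between the two last cliques. -/
def MemG2 (G : SimpleGraph V) (k : ℕ) : Prop :=
  G.Connected ∧
  ∃ (S₁ S₂ : Set V) (B₁ B₂ : ℕ → Set V),
    Disjoint S₁ S₂ ∧ S₁ ∪ S₂ = Set.univ ∧
    IsStripIn G S₁ (2 * k + 1) B₁ ∧ IsStripIn G S₂ (2 * k + 1) B₂ ∧
    (∀ u v, G.Adj u v → (u ∈ S₁ ∧ v ∈ S₁) ∨ (u ∈ S₂ ∧ v ∈ S₂) ∨
      (u ∈ B₁ (2 * k + 1) ∧ v ∈ B₂ (2 * k + 1)) ∨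
      (u ∈ B₂ (2 * k + 1) ∧ v ∈ B₁ (2 * k + 1)))

/-- `G` arises from the disjoint union of `ℓ` `2k`-strips (on the sets `S j`, with partitions
`B j`) and a possibly empty set `R` of vertices, by adding all possible edges within
`R ∪ ⋃ j, B j (2k)`. -/
def MemG0With (G : SimpleGraph V) (k : ℕ) {ℓ : ℕ} (S : Fin ℓ → Set V)
    (B : Fin ℓ → ℕ → Set V) (R : Set V) : Prop :=
  (R ∪ ⋃ j, S j) = Set.univ ∧
  (∀ j, Disjoint R (S j)) ∧
  (Pairwise fun j j' => Disjoint (S j) (S j')) ∧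
  (∀ j, IsStripIn G (S j) (2 * k) (B j)) ∧
  (∀ u v, u ≠ v → u ∈ R ∪ ⋃ j, B j (2 * k) → v ∈ R ∪ ⋃ j, B j (2 * k) → G.Adj u v) ∧
  (∀ u v, G.Adj u v → (∃ j, u ∈ S j ∧ v ∈ S j) ∨
      ((u ∈ R ∪ ⋃ j, B j (2 * k)) ∧ (v ∈ R ∪ ⋃ j, B j (2 * k))))

/-- `G` belongs to the class `𝒢₀(k, ℓ)`. -/
def MemG0 (G : SimpleGraph V) (k ℓ : ℕ) : Prop :=
  ∃ (S : Fin ℓ → Set V) (B : Fin ℓ → ℕ → Set V) (R : Set V), MemG0With G k S B R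

/-- Vertices at every distance up to the eccentricity. -/
theorem aux_exists_dist {V : Type*} [Fintype V] (G : SimpleGraph V) (hG : G.Connected)
    (x : V) (n : ℕ) (hn : n ≤ graphEcc G x) : ∃ y, G.dist x y = n := by
  obtain ⟨y, -, hy⟩ := Finset.exists_mem_eq_sup Finset.univ ⟨x, Finset.mem_univ x⟩
    (fun y => G.dist x y)
  have hy' : n ≤ G.dist x y := by
    rw [graphEcc, hy] at hn
    exact hn
  obtain ⟨w, hw⟩ := hG.exists_walk_length_eq_dist x y
  refine ⟨w.getVert n, ?_⟩
  have h1 : G.dist x (w.getVert n) ≤ n := by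
    refine (SimpleGraph.dist_le (w.take n)).trans ?_
    simp [SimpleGraph.Walk.take_length]
  have h2 : G.dist (w.getVert n) y ≤ w.length - n := by
    refine (SimpleGraph.dist_le (w.drop n)).trans ?_
    simp [SimpleGraph.Walk.drop_length]
  have h3 := hG.dist_triangle (u := x) (v := w.getVert n) (w := y)
  omega

/-- If `f` is an independent broadcast on a connected graph `G` and some vertex `x`
with `f(x) > 0` satisfies `f(x) ≡ 0 (mod 4)`, then the weight of `f` is at most `4 α(G) − 4`. -/
theorem stmt15 {V : Type*} [Fintype V] (G : SimpleGraph V) (hG : G.Connected)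
    (f : V → ℕ) (hf : IsIndepBroadcast G f)
    (h0 : ∃ x, 0 < f x ∧ f x % 4 = 0) :
    ∑ x, f x + 4 ≤ 4 * indepNum G := by
  obtain ⟨x0, hpos, hmod⟩ := h0
  obtain ⟨hB1, hB2⟩ := hf
  set m : V → ℕ := fun v => if v = x0 then f v / 4 else (f v - 1) / 4 with hm
  have hex : ∀ v i, ∃ y, i ≤ m v → G.dist v y = 2 * i := by
    intro v i
    by_cases hi : i ≤ m v
    · obtain ⟨y, hy⟩ := aux_exists_dist G hG v (2 * i) (by
        refine le_trans ?_ (hB1 v)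
        simp only [hm] at hi
        split_ifs at hi <;> omega)
      exact ⟨y, fun _ => hy⟩
    · exact ⟨v, fun h => absurd h hi⟩
  choose p hp using hex
  have key : ∀ v i w j, 0 < f v → 0 < f w → i ≤ m v → j ≤ m w → (v ≠ w ∨ i ≠ j) →
      2 ≤ G.dist (p v i) (p w j) := by
    intro v i w j hv hw hi hj hne
    have e1 := hp v i hi
    have e2 := hp w j hj
    by_cases hvw : v = w
    · subst hvw
      have hij : i ≠ j := by tauto
      have t1 := hG.dist_triangle (u := v) (v := p v i) (w := p v j)
      have t2 := hG.dist_triangle (u := v) (v := p v j) (w := p v i)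
      rw [G.dist_comm (u := p v j)] at t2
      omega
    · have hd := hB2 v w hvw hv hw
      have t1 := hG.dist_triangle (u := v) (v := p v i) (w := w)
      have t2 := hG.dist_triangle (u := p v i) (v := p w j) (w := w)
      rw [G.dist_comm (u := p w j) (v := w)] at t2
      have hb : 2 * i + 2 * j + 1 ≤ max (f v) (f w) := by
        simp only [hm] at hi hj
        by_cases h1 : v = x0
        · have h2 : w ≠ x0 := fun h => hvw (h1.trans h.symm)
          rw [if_pos h1] at hi
          rw [if_neg h2] at hj
          rw [← h1] at hmod
          omega
        · rw [if_neg h1] at hi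
          by_cases h2 : w = x0
          · rw [if_pos h2] at hj
            rw [← h2] at hmod
            omega
          · rw [if_neg h2] at hj
            omega
      omega
  set T : Finset (Σ _ : V, ℕ) :=
    (Finset.univ.filter fun v => 0 < f v).sigma fun v => Finset.range (m v + 1) with hT
  have hmem : ∀ a ∈ T, 0 < f a.1 ∧ a.2 ≤ m a.1 := by
    intro a ha
    simp only [hT, Finset.mem_sigma, Finset.mem_filter, Finset.mem_univ, true_and,
      Finset.mem_range] at ha
    omega
  have key2 : ∀ a ∈ T, ∀ b ∈ T, a ≠ b → 2 ≤ G.dist (p a.1 a.2) (p b.1 b.2) := by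
    rintro ⟨v, i⟩ ha ⟨w, j⟩ hb hab
    obtain ⟨a1, a2⟩ := hmem _ ha
    obtain ⟨b1, b2⟩ := hmem _ hb
    refine key v i w j a1 b1 a2 b2 ?_
    by_contra hc
    push Not at hc
    exact hab (by rw [hc.1, hc.2])
  have hcard : (T.image fun a => p a.1 a.2).card = T.card := by
    refine Finset.card_image_of_injOn ?_
    intro a ha b hb hab
    by_contra hne
    have := key2 a ha b hb hne
    simp only at hab
    rw [hab, SimpleGraph.dist_self] at this
    omega
  have hle : T.card ≤ indepNum G := by
    refine le_csSup ⟨Fintype.card V, ?_⟩ ⟨T.image fun a => p a.1 a.2, ?_, hcard⟩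
    · rintro n ⟨S, -, rfl⟩
      exact Finset.card_le_univ S
    · intro x hx y hy hxy hadj
      obtain ⟨a, ha, rfl⟩ := Finset.mem_image.1 hx
      obtain ⟨b, hb, rfl⟩ := Finset.mem_image.1 hy
      have hab : a ≠ b := fun h => hxy (by rw [h])
      have := key2 a ha b hb hab
      rw [SimpleGraph.dist_eq_one_iff_adj.2 hadj] at this
      omega
  have hTc : T.card = ∑ v ∈ Finset.univ.filter (fun v => 0 < f v), (m v + 1) := by
    simp [hT, Finset.card_sigma]
  have hTc' : T.card = ∑ v, if 0 < f v then m v + 1 else 0 := by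
    rw [hTc, Finset.sum_filter]
  have hsum : ∑ v, f v + 4 = ∑ v, (f v + if v = x0 then 4 else 0) := by
    rw [Finset.sum_add_distrib]
    simp
  have hfin : ∑ v, f v + 4 ≤ 4 * T.card := by
    rw [hsum, hTc', Finset.mul_sum]
    refine Finset.sum_le_sum fun v _ => ?_
    simp only [hm]
    by_cases h : v = x0
    · subst h
      simp only [if_true, hpos]
      omega
    · simp only [h, if_false]
      split_ifs <;> omega
  omega
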